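/- For 0 ≤ r < 1 and real v, ∫_0^π (1 + r² - 2r cos t)^{-v} dt = π F(v, v; 1; r²), where F is the Gauss hypergeometric function. -/

import Mathlib

open Real

/-- Pochhammer symbol `(a)_n` for real `a`. -/
noncomputable def pochR (a : ℝ) (n : ℕ) : ℝ := ∏ i ∈ Finset.range n, (a + i)

/-- Gauss hypergeometric function `F(a,b;c;x)` with real parameters. -/
noncomputable def hypFR (a b c x : ℝ) : ℝ :=
  ∑' n : ℕ, pochR a n * pochR b n / (pochR c n * (Nat.factorial n : ℝ)) * x ^ n

theorem pochR_eq_eval (a : ℝ) (n : ℕ) : (ascPochhammer ℝ n).eval a = pochR a n := by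
  induction n with
  | zero => simp [pochR]
  | succ n ih =>
    rw [ascPochhammer_succ_right, Polynomial.eval_mul, ih]
    simp [pochR, Finset.prod_range_succ]

theorem choose_eq_pochR (v : ℝ) (n : ℕ) :
    Ring.choose (v + n - 1) n = pochR v n / (Nat.factorial n : ℝ) := by
  have h := Ring.factorial_nsmul_multichoose_eq_ascPochhammer v n
  rw [Polynomial.ascPochhammer_smeval_eq_eval, pochR_eq_eval, Ring.multichoose_eq] at h
  have h0 : (Nat.factorial n : ℝ) ≠ 0 := by exact_mod_cast Nat.factorial_ne_zero n
  rw [eq_div_iff h0, ← h, nsmul_eq_mul, mul_comm]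

theorem pochR_one (n : ℕ) : pochR 1 n = (Nat.factorial n : ℝ) := by
  rw [← pochR_eq_eval, ascPochhammer_eval_one]

noncomputable def coefC (v : ℝ) (n : ℕ) : ℝ := pochR v n / (Nat.factorial n : ℝ)

theorem choose_complex (v : ℝ) (n : ℕ) :
    Ring.choose ((v : ℂ) + n - 1) n = ((coefC v n : ℝ) : ℂ) := by
  rw [coefC, ← choose_eq_pochR, Complex.ofReal_choose]
  push_cast
  rfl

theorem series_hasSum (v : ℝ) (z : ℂ) (hz : ‖z‖ < 1) :
    HasSum (fun n : ℕ => ((coefC v n : ℝ) : ℂ) * z ^ n) (1 / (1 - z) ^ (v : ℂ)) := by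
  have h := (Complex.one_div_one_sub_cpow_hasFPowerSeriesOnBall_zero (v : ℂ)).hasSum
    (y := z) (by
      rw [← ENNReal.ofReal_one, Metric.eball_ofReal]
      simpa using hz)
  simp only [FormalMultilinearSeries.ofScalars_apply_eq, choose_complex, smul_eq_mul, zero_add] at h
  exact h

theorem series_summable (v r : ℝ) (hr0 : 0 ≤ r) (hr1 : r < 1) :
    Summable (fun n : ℕ => |coefC v n| * r ^ n) := by
  have h := (series_hasSum v (r : ℂ) (by simpa [abs_of_nonneg hr0] using hr1)).summable.norm
  simpa [abs_of_nonneg hr0] using h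

theorem pointwise_val (v r t : ℝ) (z : ℂ) (hzdef : z = r * Complex.exp (t * Complex.I)) :
    ((1 / (1 - z) ^ (v : ℂ)) * (starRingEnd ℂ) (1 / (1 - z) ^ (v : ℂ))).re
      = (1 + r ^ 2 - 2 * r * Real.cos t) ^ (-v) := by
  rw [Complex.mul_conj, Complex.ofReal_re, Complex.normSq_eq_norm_sq, norm_div, norm_one,
    Complex.norm_cpow_real]
  have hn : 1 + r ^ 2 - 2 * r * Real.cos t = ‖1 - z‖ ^ 2 := by
    rw [← Complex.normSq_eq_norm_sq, Complex.normSq_apply, hzdef]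
    simp only [Complex.sub_re, Complex.sub_im, Complex.one_re, Complex.one_im,
      Complex.re_ofReal_mul, Complex.im_ofReal_mul,
      Complex.exp_ofReal_mul_I_re, Complex.exp_ofReal_mul_I_im]
    linear_combination (-r ^ 2) * Real.sin_sq_add_cos_sq t
  rw [hn, Real.rpow_neg (by positivity), one_div, inv_pow, ← Real.rpow_natCast,
    ← Real.rpow_mul (norm_nonneg _), ← Real.rpow_natCast, ← Real.rpow_mul (norm_nonneg _),
    mul_comm v]

theorem pointwise_term (a b r t : ℝ) (z : ℂ) (hzdef : z = r * Complex.exp (t * Complex.I))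
    (m n : ℕ) :
    ((a : ℂ) * z ^ m * (starRingEnd ℂ) ((b : ℂ) * z ^ n)).re
      = a * b * r ^ (m + n) * Real.cos (((m : ℝ) - n) * t) := by
  have hterm : (a : ℂ) * z ^ m * (starRingEnd ℂ) ((b : ℂ) * z ^ n)
      = ((a * b * r ^ (m + n) : ℝ) : ℂ) *
        Complex.exp (((((m : ℝ) - n) * t : ℝ) : ℂ) * Complex.I) := by
    rw [hzdef]
    simp only [map_mul, map_pow, Complex.conj_ofReal, map_natCast, ← Complex.exp_conj, Complex.conj_I, mul_pow,
      ← Complex.exp_nat_mul]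
    have : Complex.exp (((((m : ℝ) - n) * t : ℝ) : ℂ) * Complex.I)
        = Complex.exp (m * (t * Complex.I)) * Complex.exp (n * (t * -Complex.I)) := by
      rw [← Complex.exp_add]; congr 1; push_cast; ring
    rw [this]; push_cast; ring
  rw [hterm, Complex.re_ofReal_mul, Complex.exp_ofReal_mul_I_re]

theorem pair_hasSum (f : ℕ → ℂ) (s : ℂ) (h1 : HasSum f s) :
    HasSum (fun p : ℕ × ℕ => (f p.1 * (starRingEnd ℂ) (f p.2)).re)
      (s * (starRingEnd ℂ) s).re := by
  have h2 : HasSum (fun n => (starRingEnd ℂ) (f n)) ((starRingEnd ℂ) s) :=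
    h1.map (starRingEnd ℂ) Complex.continuous_conj
  have hs1 : Summable (fun n => ‖f n‖) := h1.summable.norm
  have hs2 : Summable (fun n => ‖(starRingEnd ℂ) (f n)‖) := h2.summable.norm
  have hs : Summable (fun p : ℕ × ℕ => f p.1 * (starRingEnd ℂ) (f p.2)) :=
    summable_mul_of_summable_norm (f := f) (g := fun n => (starRingEnd ℂ) (f n)) hs1 hs2
  have h3 : HasSum (fun p : ℕ × ℕ => f p.1 * (starRingEnd ℂ) (f p.2)) (s * (starRingEnd ℂ) s) :=
    HasSum.mul (f := f) (g := fun n => (starRingEnd ℂ) (f n)) h1 h2 hs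
  exact Complex.hasSum_re h3

theorem pointwise_hasSum (v r t : ℝ) (hr0 : 0 ≤ r) (hr1 : r < 1) :
    HasSum (fun p : ℕ × ℕ => coefC v p.1 * coefC v p.2 * r ^ (p.1 + p.2) *
        Real.cos (((p.1 : ℝ) - p.2) * t))
      ((1 + r ^ 2 - 2 * r * Real.cos t) ^ (-v)) := by
  obtain ⟨z, hzdef⟩ : ∃ z : ℂ, z = r * Complex.exp (t * Complex.I) := ⟨_, rfl⟩
  have hzn : ‖z‖ = r := by
    rw [hzdef, norm_mul, Complex.norm_exp_ofReal_mul_I]; simp [abs_of_nonneg hr0]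
  have h4 := pair_hasSum _ _ (series_hasSum v z (by rw [hzn]; exact hr1))
  rw [pointwise_val v r t z hzdef] at h4
  simp only [pointwise_term _ _ r t z hzdef] at h4
  exact h4

theorem integral_cos_diff (m n : ℕ) :
    ∫ t in (0:ℝ)..π, Real.cos (((m : ℝ) - n) * t) = if m = n then π else 0 := by
  split_ifs with h
  · simp [h]
  · have h0 : (m : ℝ) - n ≠ 0 := by
      rw [sub_ne_zero]; exact_mod_cast h
    rw [intervalIntegral.integral_comp_mul_left (fun x => Real.cos x) h0]
    have : Real.sin (((m : ℝ) - n) * π) = 0 := by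
      have := Real.sin_int_mul_pi ((m : ℤ) - n)
      push_cast at this
      exact this
    simp [this]

theorem stmt3 (r v : ℝ) (hr0 : 0 ≤ r) (hr1 : r < 1) :
    ∫ t in (0:ℝ)..π, (1 + r ^ 2 - 2 * r * Real.cos t) ^ (-v) =
      π * hypFR v v 1 (r ^ 2) := by
  have hs := series_summable v r hr0 hr1
  have hsum : Summable (fun p : ℕ × ℕ => (|coefC v p.1| * r ^ p.1) * (|coefC v p.2| * r ^ p.2)) :=
    hs.mul_of_nonneg hs (fun n => by positivity) (fun n => by positivity)
  have key := intervalIntegral.hasSum_integral_of_dominated_convergence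
    (μ := MeasureTheory.volume) (a := 0) (b := π)
    (F := fun (p : ℕ × ℕ) t => coefC v p.1 * coefC v p.2 * r ^ (p.1 + p.2) *
        Real.cos (((p.1 : ℝ) - p.2) * t))
    (f := fun t => (1 + r ^ 2 - 2 * r * Real.cos t) ^ (-v))
    (fun p _ => (|coefC v p.1| * r ^ p.1) * (|coefC v p.2| * r ^ p.2))
    (fun p => by
      apply Continuous.aestronglyMeasurable
      fun_prop)
    (fun p => by
      refine Filter.Eventually.of_forall fun t _ => ?_
      rw [Real.norm_eq_abs, abs_mul, abs_mul, abs_mul, abs_of_nonneg (pow_nonneg hr0 _)]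
      calc _ ≤ |coefC v p.1| * |coefC v p.2| * r ^ (p.1 + p.2) * 1 := by
            gcongr
            exact Real.abs_cos_le_one _
        _ = _ := by ring)
    (Filter.Eventually.of_forall fun t _ => hsum)
    (by simp)
    (Filter.Eventually.of_forall fun t _ => pointwise_hasSum v r t hr0 hr1)
  simp only [intervalIntegral.integral_const_mul, integral_cos_diff] at key
  have hinj : Function.Injective (fun n : ℕ => (n, n)) := fun a b h => (Prod.mk.inj h).1
  have key2 := (hinj.hasSum_iff (by
    rintro ⟨m, n⟩ hmn
    have : m ≠ n := by
      rintro rfl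
      exact hmn ⟨m, rfl⟩
    simp [this])).mpr key
  rw [← key2.tsum_eq, hypFR, ← tsum_mul_left]
  congr 1
  ext n
  simp only [Function.comp, if_true, coefC, pochR_one]
  ring
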